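/- arXiv:2303.02619 — 8 statements merged into one kernel-verified Lean document; each statement's English description precedes it below -/
import Mathlib

section
/- Let (H, S_b, s) be a symmetric S_b-metric space with coefficient s ≥ 1, and let CB(H) be the family of nonempty, closed, bounded subsets of H. Then the function H_b : CB(H)³ → [0,∞) defined by H_b(P,R,Q) = max{ max(sup_{p∈P} D_b(p,R), sup_{p∈P} D_b(p,Q)), max(sup_{r∈R} D_b(r,P), sup_{r∈R} D_b(r,Q)), max(sup_{q∈Q} D_b(q,P), sup_{q∈Q} D_b(q,R)) } is an S_b-metric on CB(H) with coefficient k = 4s; that is, H_b(P,R,Q) = 0 if and only if P = R = Q, and H_b(P,R,Q) ≤ 4s[H_b(P,P,M) + H_b(R,R,M) + H_b(Q,Q,M)] for all P,R,Q,M ∈ CB(H). -/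
open Filter Topology

/-- `D_b(h, R) = inf { S_b(h,h,r) : r ∈ R }`. -/
noncomputable def Db {H : Type*} (Sb : H → H → H → ℝ) (h : H) (R : Set H) : ℝ :=
  sInf ((fun r => Sb h h r) '' R)

/-- The generalized Hausdorff function `H_b(P,R,Q)`. -/
noncomputable def Hb {H : Type*} (Sb : H → H → H → ℝ) (P R Q : Set H) : ℝ :=
  max (max (sSup ((fun p => Db Sb p R) '' P)) (sSup ((fun p => Db Sb p Q) '' P)))
    (max (max (sSup ((fun r => Db Sb r P) '' R)) (sSup ((fun r => Db Sb r Q) '' R)))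
      (max (sSup ((fun q => Db Sb q P) '' Q)) (sSup ((fun q => Db Sb q R) '' Q))))

/-- A sequence `x` converges to `a` iff `S_b(x n, x n, a) → 0`. -/
def SbConvergesTo {H : Type*} (Sb : H → H → H → ℝ) (x : ℕ → H) (a : H) : Prop :=
  Filter.Tendsto (fun n => Sb (x n) (x n) a) Filter.atTop (nhds 0)

/-- A set is closed iff it contains all limits of convergent sequences of its elements. -/
def SbClosed {H : Type*} (Sb : H → H → H → ℝ) (A : Set H) : Prop :=
  ∀ (x : ℕ → H) (a : H), (∀ n, x n ∈ A) → SbConvergesTo Sb x a → a ∈ A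

/-- A set is bounded iff its diameter `sup {S_b(h,u,v) : h,u,v ∈ K}` is finite. -/
def SbBounded {H : Type*} (Sb : H → H → H → ℝ) (K : Set H) : Prop :=
  ∃ M : ℝ, ∀ h ∈ K, ∀ u ∈ K, ∀ v ∈ K, Sb h u v ≤ M

/-- A sequence is Cauchy iff `S_b(x n, x n, x m) → 0` as `n, m → ∞`. -/
def SbCauchy {H : Type*} (Sb : H → H → H → ℝ) (x : ℕ → H) : Prop :=
  Filter.Tendsto (fun p : ℕ × ℕ => Sb (x p.1) (x p.1) (x p.2)) Filter.atTop (nhds 0)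

/-- A space is complete iff every Cauchy sequence converges. -/
def SbComplete {H : Type*} (Sb : H → H → H → ℝ) : Prop :=
  ∀ x : ℕ → H, SbCauchy Sb x → ∃ a, SbConvergesTo Sb x a

/-- `K` belongs to `CB(H)`: nonempty, closed and bounded. -/
def IsCB {H : Type*} (Sb : H → H → H → ℝ) (K : Set H) : Prop :=
  K.Nonempty ∧ SbClosed Sb K ∧ SbBounded Sb K

/-- `N(ε, P, R) = { h : D_b(h,P) ≤ ε and D_b(h,R) ≤ ε }`. -/
def NSet {H : Type*} (Sb : H → H → H → ℝ) (ε : ℝ) (P R : Set H) : Set H :=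
  {h | Db Sb h P ≤ ε ∧ Db Sb h R ≤ ε}



lemma aux_bddBelow {H : Type*} {Sb : H → H → H → ℝ} (hnonneg : ∀ u w v, 0 ≤ Sb u w v)
    (h : H) (R : Set H) : BddBelow ((fun r => Sb h h r) '' R) := by
  refine ⟨0, ?_⟩
  rintro _ ⟨r, _, rfl⟩
  exact hnonneg _ _ _

lemma aux_Db_le {H : Type*} {Sb : H → H → H → ℝ} (hnonneg : ∀ u w v, 0 ≤ Sb u w v)
    (h : H) {R : Set H} {r : H} (hr : r ∈ R) : Db Sb h R ≤ Sb h h r :=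
  csInf_le (aux_bddBelow hnonneg h R) ⟨r, hr, rfl⟩

lemma aux_le_Db {H : Type*} {Sb : H → H → H → ℝ}
    (h : H) {R : Set H} (hR : R.Nonempty) {c : ℝ} (hc : ∀ r ∈ R, c ≤ Sb h h r) : c ≤ Db Sb h R := by
  refine le_csInf (hR.image _) ?_
  rintro _ ⟨r, hr, rfl⟩
  exact hc r hr

lemma aux_exists {H : Type*} {Sb : H → H → H → ℝ}
    (h : H) {R : Set H} (hR : R.Nonempty) {c : ℝ} (hc : Db Sb h R < c) : ∃ r ∈ R, Sb h h r < c := by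
  by_contra! hh
  exact absurd (aux_le_Db h hR hh) (not_le.2 hc)

lemma aux_le_E {H : Type*} {s : ℝ} (hs : 1 ≤ s) {Sb : H → H → H → ℝ}
    (hnonneg : ∀ u w v, 0 ≤ Sb u w v)
    (htri : ∀ u w v t, Sb u w v ≤ s * (Sb u u t + Sb w w t + Sb v v t))
    {P R : Set H} (hP : IsCB Sb P) (hR : IsCB Sb R) {p : H} (hp : p ∈ P) :
    Db Sb p R ≤ sSup ((fun p => Db Sb p R) '' P) := by
  obtain ⟨p0, hp0⟩ := hP.1
  obtain ⟨r0, hr0⟩ := hR.1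
  obtain ⟨C, hC⟩ := hP.2.2
  refine le_csSup ⟨s * (C + C + Sb r0 r0 p0), ?_⟩ ⟨p, hp, rfl⟩
  rintro _ ⟨q, hq, rfl⟩
  refine (aux_Db_le hnonneg q hr0).trans ((htri q q r0 p0).trans ?_)
  have := hC q hq q hq p0 hp0
  gcongr

lemma aux_E_le {H : Type*} {Sb : H → H → H → ℝ}
    {P R : Set H} (hP : P.Nonempty) {c : ℝ} (hc : ∀ p ∈ P, Db Sb p R ≤ c) :
    sSup ((fun p => Db Sb p R) '' P) ≤ c := by
  refine csSup_le (hP.image _) ?_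
  rintro _ ⟨r, hr, rfl⟩
  exact hc r hr

lemma aux_E_nonneg {H : Type*} {s : ℝ} (hs : 1 ≤ s) {Sb : H → H → H → ℝ}
    (hnonneg : ∀ u w v, 0 ≤ Sb u w v)
    (htri : ∀ u w v t, Sb u w v ≤ s * (Sb u u t + Sb w w t + Sb v v t))
    {P R : Set H} (hP : IsCB Sb P) (hR : IsCB Sb R) :
    0 ≤ sSup ((fun p => Db Sb p R) '' P) := by
  obtain ⟨p0, hp0⟩ := hP.1
  exact (aux_le_Db p0 hR.1 (fun r _ => hnonneg _ _ _)).trans (aux_le_E hs hnonneg htri hP hR hp0)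

lemma aux_E_tri {H : Type*} {s : ℝ} (hs : 1 ≤ s) {Sb : H → H → H → ℝ}
    (hnonneg : ∀ u w v, 0 ≤ Sb u w v)
    (htri : ∀ u w v t, Sb u w v ≤ s * (Sb u u t + Sb w w t + Sb v v t))
    (hsym : ∀ u w, Sb u u w = Sb w w u)
    {P R M : Set H} (hP : IsCB Sb P) (hR : IsCB Sb R) (hM : IsCB Sb M) :
    sSup ((fun p => Db Sb p R) '' P) ≤
      s * (2 * sSup ((fun p => Db Sb p M) '' P) + sSup ((fun p => Db Sb p R) '' M)) := by
  refine aux_E_le hP.1 fun p hp => ?_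
  refine le_of_forall_pos_le_add fun e he => ?_
  have hs0 : 0 < s := by linarith
  have hd : 0 < e / (3 * s) := by positivity
  obtain ⟨m, hm, h1⟩ := aux_exists p hM.1 (lt_add_of_pos_right (Db Sb p M) hd)
  obtain ⟨r, hr, h2⟩ := aux_exists m hR.1 (lt_add_of_pos_right (Db Sb m R) hd)
  have h3 := aux_le_E hs hnonneg htri hP hM hp
  have h4 := aux_le_E hs hnonneg htri hM hR hm
  have h5 := htri p p r m
  rw [hsym r m] at h5
  have h6 := aux_Db_le hnonneg p hr
  have h7 : s * (Sb p p m + Sb p p m + Sb m m r) ≤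
    s * (2 * sSup ((fun p => Db Sb p M) '' P) + sSup ((fun p => Db Sb p R) '' M)
      + 3 * (e / (3 * s))) := by
    apply mul_le_mul_of_nonneg_left _ hs0.le
    linarith
  have h8 : s * (3 * (e / (3 * s))) = e := by field_simp
  rw [mul_add s _ (3 * (e / (3 * s))), h8] at h7
  linarith

lemma aux_subset {H : Type*} {s : ℝ} (hs : 1 ≤ s) {Sb : H → H → H → ℝ}
    (hnonneg : ∀ u w v, 0 ≤ Sb u w v)
    (htri : ∀ u w v t, Sb u w v ≤ s * (Sb u u t + Sb w w t + Sb v v t))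
    (hsym : ∀ u w, Sb u u w = Sb w w u)
    {P R : Set H} (hP : IsCB Sb P) (hR : IsCB Sb R)
    (h : sSup ((fun p => Db Sb p R) '' P) ≤ 0) : P ⊆ R := by
  intro p hp
  have h0 := (aux_le_E hs hnonneg htri hP hR hp).trans h
  have : ∀ n : ℕ, ∃ r ∈ R, Sb p p r < 1 / ((n : ℝ) + 1) := fun n =>
    aux_exists p hR.1 (h0.trans_lt Nat.one_div_pos_of_nat)
  choose x hx hx' using this
  refine hR.2.1 x p hx ?_
  refine squeeze_zero (fun n => hnonneg _ _ _) (fun n => ?_) tendsto_one_div_add_atTop_nhds_zero_nat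
  rw [hsym]
  exact (hx' n).le

theorem stmt_0 {H : Type*}
    (s : ℝ) (hs : 1 ≤ s) (Sb : H → H → H → ℝ)
    (hnonneg : ∀ u w v, 0 ≤ Sb u w v)
    (hzero : ∀ u w v, Sb u w v = 0 ↔ u = w ∧ w = v)
    (htri : ∀ u w v t, Sb u w v ≤ s * (Sb u u t + Sb w w t + Sb v v t))
    (hsym : ∀ u w, Sb u u w = Sb w w u) :
    (∀ P R Q : Set H, IsCB Sb P → IsCB Sb R → IsCB Sb Q →
      (Hb Sb P R Q = 0 ↔ P = R ∧ R = Q)) ∧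
    (∀ P R Q M : Set H, IsCB Sb P → IsCB Sb R → IsCB Sb Q → IsCB Sb M →
      Hb Sb P R Q ≤ 4 * s * (Hb Sb P P M + Hb Sb R R M + Hb Sb Q Q M)) := by
  refine ⟨?_, ?_⟩
  · intro P R Q hP hR hQ
    constructor
    · intro h
      have h' := h.le
      simp only [Hb, max_le_iff] at h'
      obtain ⟨⟨a, b⟩, ⟨c, d⟩, e, f⟩ := h'
      exact ⟨(aux_subset hs hnonneg htri hsym hP hR a).antisymm
        (aux_subset hs hnonneg htri hsym hR hP c),
        (aux_subset hs hnonneg htri hsym hR hQ d).antisymm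
        (aux_subset hs hnonneg htri hsym hQ hR f)⟩
    · rintro ⟨rfl, rfl⟩
      have h0 : sSup ((fun p => Db Sb p P) '' P) = 0 := by
        refine le_antisymm (aux_E_le hP.1 fun p hp => ?_) (aux_E_nonneg hs hnonneg htri hP hP)
        exact (aux_Db_le hnonneg p hp).trans ((hzero p p p).2 ⟨rfl, rfl⟩).le
      simp only [Hb, h0, max_self]
  · intro P R Q M hP hR hQ hM
    have key : ∀ A B : Set H, IsCB Sb A → IsCB Sb B →
        sSup ((fun p => Db Sb p B) '' A) ≤ 4 * s * (Hb Sb A A M + Hb Sb B B M) := by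
      intro A B hA hB
      have h1 : sSup ((fun p => Db Sb p M) '' A) ≤ Hb Sb A A M := by simp [Hb]
      have h2 : sSup ((fun p => Db Sb p B) '' M) ≤ Hb Sb B B M := by simp [Hb]
      have h3 := aux_E_nonneg hs hnonneg htri hA hM
      have h4 := aux_E_nonneg hs hnonneg htri hM hB
      refine (aux_E_tri hs hnonneg htri hsym hA hB hM).trans ?_
      rw [mul_comm 4 s, mul_assoc]
      apply mul_le_mul_of_nonneg_left _ (by linarith)
      linarith
    have pos : ∀ A : Set H, IsCB Sb A → 0 ≤ 4 * s * Hb Sb A A M := by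
      intro A hA
      have h1 : sSup ((fun p => Db Sb p M) '' A) ≤ Hb Sb A A M := by simp [Hb]
      have h3 := (aux_E_nonneg hs hnonneg htri hA hM).trans h1
      positivity
    have pP := pos P hP
    have pR := pos R hR
    have pQ := pos Q hQ
    have k1 := key P R hP hR
    have k2 := key P Q hP hQ
    have k3 := key R P hR hP
    have k4 := key R Q hR hQ
    have k5 := key Q P hQ hP
    have k6 := key Q R hQ hR
    rw [Hb]
    simp only [max_le_iff]
    refine ⟨⟨?_, ?_⟩, ⟨?_, ?_⟩, ?_, ?_⟩ <;> linarith
end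

section
/- Let (H, S_b, s) be a symmetric S_b-metric space with coefficient s ≥ 1 and let P, R, Q, M be nonempty bounded subsets of H. Then H_b(P,R,Q) ≤ 4s[H_b(P,P,M) + H_b(R,R,M) + H_b(Q,Q,M)]. -/
open Filter Topology

theorem aux_bdd {H : Type*} (s : ℝ) (hs : 1 ≤ s) (Sb : H → H → H → ℝ)
    (hnonneg : ∀ u w v, 0 ≤ Sb u w v)
    (htri : ∀ u w v t, Sb u w v ≤ s * (Sb u u t + Sb w w t + Sb v v t))
    (X Y : Set H) (hX : X.Nonempty) (hXb : SbBounded Sb X) (hY : Y.Nonempty) :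
    ∀ x ∈ X, Db Sb x Y ≤ sSup ((fun p => Db Sb p Y) '' X) := by
  intro x hx
  refine le_csSup ?_ (Set.mem_image_of_mem (fun p => Db Sb p Y) hx)
  obtain ⟨x0, hx0⟩ := hX
  obtain ⟨y0, hy0⟩ := hY
  obtain ⟨K, hK⟩ := hXb
  refine ⟨s * (K + K + Sb y0 y0 x0), ?_⟩
  rintro _ ⟨p, hp, rfl⟩
  have h1 : Db Sb p Y ≤ Sb p p y0 :=
    csInf_le ⟨0, by rintro _ ⟨r, _, rfl⟩; exact hnonneg _ _ _⟩ ⟨y0, hy0, rfl⟩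
  have h2 := hK p hp p hp x0 hx0
  refine (h1.trans (htri p p y0 x0)).trans ?_
  exact mul_le_mul_of_nonneg_left (by linarith) (by linarith)

theorem aux_Db_nonneg {H : Type*} (Sb : H → H → H → ℝ)
    (hnonneg : ∀ u w v, 0 ≤ Sb u w v) (x : H) (Y : Set H) : 0 ≤ Db Sb x Y := by
  apply Real.sInf_nonneg
  rintro _ ⟨r, _, rfl⟩
  exact hnonneg _ _ _

theorem aux_Hb_nonneg {H : Type*} (Sb : H → H → H → ℝ)
    (hnonneg : ∀ u w v, 0 ≤ Sb u w v) (X Y Z : Set H) : 0 ≤ Hb Sb X Y Z := by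
  unfold Hb
  refine le_max_of_le_left (le_max_of_le_left ?_)
  apply Real.sSup_nonneg
  rintro _ ⟨r, _, rfl⟩
  exact aux_Db_nonneg Sb hnonneg _ _

theorem aux_key {H : Type*} (s : ℝ) (hs : 1 ≤ s) (Sb : H → H → H → ℝ)
    (hnonneg : ∀ u w v, 0 ≤ Sb u w v)
    (htri : ∀ u w v t, Sb u w v ≤ s * (Sb u u t + Sb w w t + Sb v v t))
    (hsym : ∀ u w, Sb u u w = Sb w w u)
    (M : Set H) (hM : M.Nonempty) (hMb : SbBounded Sb M)
    (X Y : Set H) (hX : X.Nonempty) (hXb : SbBounded Sb X) (hY : Y.Nonempty) :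
    sSup ((fun p => Db Sb p Y) '' X) ≤ s * (2 * Hb Sb X X M + Hb Sb Y Y M) := by
  apply csSup_le (hX.image _)
  rintro _ ⟨x, hx, rfl⟩
  apply le_of_forall_pos_le_add
  intro e he
  have hs0 : 0 < s := by linarith
  have hd : 0 < e / (3 * s) := by positivity
  have hA : Db Sb x M ≤ Hb Sb X X M :=
    (aux_bdd s hs Sb hnonneg htri X M hX hXb hM x hx).trans
      (le_max_of_le_left (le_max_right _ _))
  have hA' : sInf ((fun r => Sb x x r) '' M) < Hb Sb X X M + e / (3 * s) := by
    unfold Db at hA; linarith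
  obtain ⟨_, ⟨m, hm, rfl⟩, h1⟩ := exists_lt_of_csInf_lt (hM.image _) hA'
  have hB : Db Sb m Y ≤ Hb Sb Y Y M :=
    (aux_bdd s hs Sb hnonneg htri M Y hM hMb hY m hm).trans
      (le_max_of_le_right (le_max_of_le_right (le_max_right _ _)))
  have hB' : sInf ((fun r => Sb m m r) '' Y) < Hb Sb Y Y M + e / (3 * s) := by
    unfold Db at hB; linarith
  obtain ⟨_, ⟨y, hy, rfl⟩, h2⟩ := exists_lt_of_csInf_lt (hY.image _) hB'
  have h3 : Db Sb x Y ≤ Sb x x y :=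
    csInf_le ⟨0, by rintro _ ⟨r, _, rfl⟩; exact hnonneg _ _ _⟩ ⟨y, hy, rfl⟩
  have h4 := htri x x y m
  rw [hsym y m] at h4
  simp only at h1 h2
  have h5 : s * (Sb x x m + Sb x x m + Sb m m y) ≤
      s * (2 * Hb Sb X X M + Hb Sb Y Y M + 3 * (e / (3 * s))) :=
    mul_le_mul_of_nonneg_left (by linarith) hs0.le
  have h6 : s * (3 * (e / (3 * s))) = e := by field_simp
  show Db Sb x Y ≤ _
  rw [mul_add s (2 * Hb Sb X X M + Hb Sb Y Y M), h6] at h5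
  linarith

theorem stmt_3 {H : Type*}
    (s : ℝ) (hs : 1 ≤ s) (Sb : H → H → H → ℝ)
    (hnonneg : ∀ u w v, 0 ≤ Sb u w v)
    (hzero : ∀ u w v, Sb u w v = 0 ↔ u = w ∧ w = v)
    (htri : ∀ u w v t, Sb u w v ≤ s * (Sb u u t + Sb w w t + Sb v v t))
    (hsym : ∀ u w, Sb u u w = Sb w w u)
    (P R Q M : Set H)
    (hP : P.Nonempty) (hPb : SbBounded Sb P)
    (hR : R.Nonempty) (hRb : SbBounded Sb R)
    (hQ : Q.Nonempty) (hQb : SbBounded Sb Q)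
    (hM : M.Nonempty) (hMb : SbBounded Sb M) :
    Hb Sb P R Q ≤ 4 * s * (Hb Sb P P M + Hb Sb R R M + Hb Sb Q Q M) := by
  have a := aux_Hb_nonneg Sb hnonneg P P M
  have b := aux_Hb_nonneg Sb hnonneg R R M
  have c := aux_Hb_nonneg Sb hnonneg Q Q M
  have key := aux_key s hs Sb hnonneg htri hsym M hM hMb
  have fin : ∀ x t : ℝ, x ≤ s * t → t ≤ 4 * (Hb Sb P P M + Hb Sb R R M + Hb Sb Q Q M) →
      x ≤ 4 * s * (Hb Sb P P M + Hb Sb R R M + Hb Sb Q Q M) := by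
    intro x t h1 h2
    have := mul_le_mul_of_nonneg_left h2 (by linarith : (0 : ℝ) ≤ s)
    linarith
  rw [Hb]
  refine max_le (max_le ?_ ?_) (max_le (max_le ?_ ?_) (max_le ?_ ?_))
  · exact fin _ _ (key P R hP hPb hR) (by linarith)
  · exact fin _ _ (key P Q hP hPb hQ) (by linarith)
  · exact fin _ _ (key R P hR hRb hP) (by linarith)
  · exact fin _ _ (key R Q hR hRb hQ) (by linarith)
  · exact fin _ _ (key Q P hQ hQb hP) (by linarith)
  · exact fin _ _ (key Q R hQ hQb hR) (by linarith)
end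

section
/- (Generalization of Nadler's fixed point theorem to S_b-metric spaces.) Let (H, S_b, s) be a complete symmetric S_b-metric space with coefficient s ≥ 1, let CB(H) be the family of nonempty, closed, bounded subsets of H, and let T : H → CB(H) be a multivalued map that is continuous in the sense that h_n → h implies H_b(T h_n, T h_n, T h) → 0, and that satisfies H_b(T h, T h, T g) ≤ α S_b(h,h,g) for all h, g ∈ H, where 0 ≤ α < 1/s. Then there exists h ∈ H with h ∈ T h. -/
open Filter Topology

theorem stmt_8 {H : Type*} [Nonempty H]
    (s : ℝ) (hs : 1 ≤ s) (Sb : H → H → H → ℝ)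
    (hnonneg : ∀ u w v, 0 ≤ Sb u w v)
    (hzero : ∀ u w v, Sb u w v = 0 ↔ u = w ∧ w = v)
    (htri : ∀ u w v t, Sb u w v ≤ s * (Sb u u t + Sb w w t + Sb v v t))
    (hsym : ∀ u w, Sb u u w = Sb w w u)
    (hcomp : SbComplete Sb)
    (T : H → Set H) (hT : ∀ h, IsCB Sb (T h))
    (hcont : ∀ (x : ℕ → H) (h : H), SbConvergesTo Sb x h →
      Filter.Tendsto (fun n => Hb Sb (T (x n)) (T (x n)) (T h)) Filter.atTop (nhds 0))
    (α : ℝ) (hα0 : 0 ≤ α) (hα : α < 1 / s)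
    (hcontr : ∀ h g : H, Hb Sb (T h) (T h) (T g) ≤ α * Sb h h g) :
    ∃ h : H, h ∈ T h := by
  classical
  have hs0 : 0 < s := by linarith
  have hα1 : α < 1 := lt_of_lt_of_le hα (by rw [div_le_one hs0]; exact hs)
  obtain ⟨d, hd⟩ : ∃ d : H → H → ℝ, ∀ u w, d u w = Sb u u w := ⟨fun u w => Sb u u w, fun _ _ => rfl⟩
  obtain ⟨K, hK⟩ : ∃ K : ℝ, K = 2 * s := ⟨_, rfl⟩
  have hK0 : 0 < K := by linarith
  have dnn : ∀ u w, 0 ≤ d u w := fun u w => by rw [hd]; exact hnonneg _ _ _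
  have dsym : ∀ u w, d u w = d w u := fun u w => by rw [hd, hd]; exact hsym _ _
  have dtri : ∀ u t w, d u w ≤ K * (d u t + d t w) := by
    intro u t w
    have h1 := htri u u w t
    rw [← hd, ← hd, ← hd, dsym w t] at h1
    have := mul_nonneg hs0.le (dnn t w)
    rw [hK]; nlinarith
  -- key selection lemma
  have key : ∀ x y p, p ∈ T x → ∀ ε, α * d x y < ε → ∃ z ∈ T y, d p z < ε := by
    intro x y p hp ε hε
    obtain ⟨q0, hq0⟩ := (hT y).1
    obtain ⟨M, hM⟩ := (hT x).2.2
    have bdb : ∀ r, BddBelow ((fun z => Sb r r z) '' T y) := by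
      intro r
      refine ⟨0, ?_⟩
      rintro _ ⟨z, _, rfl⟩
      exact hnonneg _ _ _
    have bda : BddAbove ((fun r => Db Sb r (T y)) '' T x) := by
      refine ⟨K * (M + d p q0), ?_⟩
      rintro _ ⟨r, hr, rfl⟩
      have h1 : Db Sb r (T y) ≤ d r q0 := by
        rw [hd]
        exact csInf_le (bdb r) ⟨q0, hq0, rfl⟩
      have h2 : d r p ≤ M := by rw [hd]; exact hM r hr r hr p hp
      have h3 := dtri r p q0
      have h4 : K * (d r p + d p q0) ≤ K * (M + d p q0) := by gcongr
      exact h1.trans (h3.trans h4)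
    have h1 : Db Sb p (T y) ≤ sSup ((fun r => Db Sb r (T y)) '' T x) :=
      le_csSup bda ⟨p, hp, rfl⟩
    have h2 : sSup ((fun r => Db Sb r (T y)) '' T x) ≤ Hb Sb (T x) (T x) (T y) :=
      le_trans (le_max_right _ _) (le_max_left _ _)
    have h3 := hcontr x y
    rw [← hd] at h3
    have h4 : Db Sb p (T y) < ε := by linarith
    obtain ⟨_, ⟨z, hz, rfl⟩, hlt⟩ := exists_lt_of_csInf_lt (Set.Nonempty.image (fun r => Sb p p r) ⟨q0, hq0⟩) h4
    exact ⟨z, hz, by rw [hd]; exact hlt⟩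
  by_contra hno
  push Not at hno
  obtain ⟨β, hαβ, hβ1⟩ := exists_between hα1
  have hβ0 : 0 < β := by linarith
  have step : ∀ x y, y ∈ T x → ∃ z ∈ T y, d y z ≤ β * d x y := by
    intro x y hy
    have hpos : 0 < d x y := by
      rcases (dnn x y).lt_or_eq with h | h
      · exact h
      · exfalso
        have h' := h.symm
        rw [hd, hzero] at h'
        apply hno x
        have e := h'.2
        rw [← e] at hy
        exact hy
    obtain ⟨z, hz, h⟩ := key x y y hy (β * d x y) (by gcongr)
    exact ⟨z, hz, h.le⟩
  let P := {p : H × H // p.2 ∈ T p.1}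
  choose! f hf hf2 using step
  obtain ⟨x0⟩ := ‹Nonempty H›
  obtain ⟨x1, hx1⟩ := (hT x0).1
  let F : P → P := fun p => ⟨(p.1.2, f p.1.1 p.1.2), hf _ _ p.2⟩
  let q : ℕ → P := fun n => F^[n] ⟨(x0, x1), hx1⟩
  have hq : ∀ n, q (n+1) = F (q n) := fun n => Function.iterate_succ_apply' F n _
  obtain ⟨x, hx⟩ : ∃ x : ℕ → H, ∀ n, x n = (q n).1.1 := ⟨fun n => (q n).1.1, fun _ => rfl⟩
  have hx' : ∀ n, x (n+1) = (q n).1.2 := fun n => by rw [hx, hq]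
  have hmem : ∀ n, x (n+1) ∈ T (x n) := fun n => by
    rw [hx', hx]; exact (q n).2
  have hstep : ∀ n, d (x (n+1)) (x (n+2)) ≤ β * d (x n) (x (n+1)) := fun n => by
    have e : x (n+2) = f (q n).1.1 (q n).1.2 := by rw [hx' (n+1), hq]
    rw [e, hx', hx]
    exact hf2 _ _ (q n).2
  obtain ⟨C, hC⟩ : ∃ C, C = d (x 0) (x 1) := ⟨_, rfl⟩
  have hC0 : 0 ≤ C := hC ▸ dnn _ _
  have hgeo : ∀ n, d (x n) (x (n+1)) ≤ C * β^n := by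
    intro n
    induction n with
    | zero => simp [hC]
    | succ n ih =>
      calc _ ≤ _ := hstep n
        _ ≤ β * (C * β^n) := by gcongr
        _ = _ := by ring
  have dself : ∀ u, d u u = 0 := fun u => by rw [hd, hzero]; exact ⟨rfl, rfl⟩
  have hA : ∀ m : ℕ, ∃ A, 0 ≤ A ∧ ∀ p ≤ m, ∀ n, d (x n) (x (n+p)) ≤ A * β^n := by
    intro m
    induction m with
    | zero =>
      refine ⟨0, le_rfl, ?_⟩
      intro p hp n
      obtain rfl : p = 0 := by omega
      simp [dself]
    | succ m ih =>
      obtain ⟨A, hA0, hA⟩ := ih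
      refine ⟨A + K * (A + C), by positivity, ?_⟩
      intro p hp n
      have hb : 0 ≤ β^n := by positivity
      rcases Nat.lt_or_ge m p with h | h
      · obtain rfl : p = m + 1 := by omega
        have h1 := dtri (x n) (x (n+m)) (x (n+m+1))
        have h2 := hA m le_rfl n
        have h3 := hgeo (n+m)
        have h4 : β^(n+m) ≤ β^n := pow_le_pow_of_le_one hβ0.le hβ1.le (by omega)
        calc d (x n) (x (n+(m+1))) ≤ _ := h1
          _ ≤ K * (A * β^n + C * β^n) := by
            gcongr
            exact h3.trans (by gcongr)
          _ ≤ (A + K * (A + C)) * β^n := by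
            have := mul_nonneg hA0 hb
            nlinarith
      · have h1 := hA p h n
        have : 0 ≤ K * (A + C) * β^n := by positivity
        nlinarith
  obtain ⟨m0, hm0⟩ := exists_pow_lt_of_lt_one (show (0:ℝ) < 1 / (2*K) by positivity) hβ1
  obtain ⟨m, hm1, hm⟩ : ∃ m : ℕ, 0 < m ∧ K * β^m ≤ 1/2 := by
    refine ⟨m0+1, by omega, ?_⟩
    have h4 : β^(m0+1) ≤ β^m0 := pow_le_pow_of_le_one hβ0.le hβ1.le (by omega)
    calc K * β^(m0+1) ≤ K * (1/(2*K)) := by gcongr; linarith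
      _ = 1/2 := by field_simp
  obtain ⟨A, hA0, hA⟩ := hA m
  have hB : ∀ p n, d (x n) (x (n+p)) ≤ (A + 2*K*A) * β^n := by
    intro p
    induction p using Nat.strong_induction_on with
    | _ p ih =>
      intro n
      have hb : 0 ≤ β^n := by positivity
      rcases Nat.lt_or_ge m p with h | h
      · have h1 := dtri (x n) (x (n+m)) (x (n+p))
        have h2 := hA m le_rfl n
        have h3 := ih (p-m) (by omega) (n+m)
        rw [show n+m+(p-m) = n+p by omega] at h3
        have hAb := mul_nonneg hA0 hb
        calc d (x n) (x (n+p)) ≤ _ := h1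
          _ ≤ K * (A * β^n + (A + 2*K*A) * β^(n+m)) := by gcongr
          _ = K * A * β^n + (K * β^m) * ((A + 2*K*A) * β^n) := by rw [pow_add]; ring
          _ ≤ K * A * β^n + (1/2) * ((A + 2*K*A) * β^n) := by gcongr
          _ ≤ _ := by nlinarith
      · have h1 := hA p h n
        have : 0 ≤ 2 * K * A * β^n := by positivity
        nlinarith
  have hcau : SbCauchy Sb x := by
    unfold SbCauchy
    have hlim : Tendsto (fun n : ℕ => (A + 2*K*A) * β^n) atTop (𝓝 0) := by
      simpa using (tendsto_pow_atTop_nhds_zero_of_lt_one hβ0.le hβ1).const_mul (A + 2*K*A)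
    rw [← prod_atTop_atTop_eq]
    have l1 := hlim.comp (tendsto_fst (f := (atTop : Filter ℕ)) (g := (atTop : Filter ℕ)))
    have l2 := hlim.comp (tendsto_snd (f := (atTop : Filter ℕ)) (g := (atTop : Filter ℕ)))
    have l3 := l1.add l2
    rw [add_zero] at l3
    refine squeeze_zero (fun _ => hnonneg _ _ _) ?_ l3
    rintro ⟨i, j⟩
    have p1 : 0 ≤ (A + 2*K*A) * β^i := by positivity
    have p2 : 0 ≤ (A + 2*K*A) * β^j := by positivity
    simp only [Function.comp, ← hd]
    rcases le_total i j with h | h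
    · have := hB (j-i) i
      rw [show i + (j-i) = j by omega] at this
      linarith
    · have := hB (i-j) j
      rw [show j + (i-j) = i by omega, dsym] at this
      linarith
  obtain ⟨a, ha⟩ := hcomp x hcau
  have ha' : Tendsto (fun n => d (x n) a) atTop (𝓝 0) := by
    simp only [hd]; exact ha
  have hz : ∀ n : ℕ, ∃ z ∈ T a, d (x (n+1)) z < α * d (x n) a + 1/((n:ℝ)+1) := fun n =>
    key (x n) a (x (n+1)) (hmem n) _ (by
      have : 0 < 1/((n:ℝ)+1) := by positivity
      linarith)
  choose z hzT hzd using hz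
  apply hno a
  apply (hT a).2.1 z a hzT
  have l : Tendsto (fun n : ℕ => K * ((α * d (x n) a + 1/((n:ℝ)+1)) + d (x (n+1)) a)) atTop (𝓝 0) := by
    have := (((ha'.const_mul α).add tendsto_one_div_add_atTop_nhds_zero_nat).add
      (ha'.comp (tendsto_add_atTop_nat 1))).const_mul K
    simpa using this
  refine squeeze_zero (fun _ => hnonneg _ _ _) ?_ l
  intro n
  rw [← hd]
  refine (dtri (z n) (x (n+1)) a).trans ?_
  have := hzd n
  rw [dsym] at this
  gcongr
end

section
/- Let (H, S_b, s) be a symmetric S_b-metric space with coefficient s ≥ 1, let T : H → CB(H) satisfy H_b(T h, T h, T g) ≤ α S_b(h,h,g) for all h,g ∈ H with 0 ≤ α < 1/s, and let {h_i} be a sequence in H with h_{i+1} ∈ T h_i for all i ≥ 0 and S_b(h_i, h_i, h_{i+1}) ≤ H_b(T h_{i-1}, T h_{i-1}, T h_i) + α^i for all i ≥ 1. Then S_b(h_i, h_i, h_{i+1}) ≤ α^i S_b(h_0, h_0, h_1) + i α^i for all i ≥ 1. -/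
open Filter Topology

theorem stmt_9 {H : Type*}
    (s : ℝ) (hs : 1 ≤ s) (Sb : H → H → H → ℝ)
    (hnonneg : ∀ u w v, 0 ≤ Sb u w v)
    (hzero : ∀ u w v, Sb u w v = 0 ↔ u = w ∧ w = v)
    (htri : ∀ u w v t, Sb u w v ≤ s * (Sb u u t + Sb w w t + Sb v v t))
    (hsym : ∀ u w, Sb u u w = Sb w w u)
    (T : H → Set H) (hT : ∀ h, IsCB Sb (T h))
    (α : ℝ) (hα0 : 0 ≤ α) (hα : α < 1 / s)
    (hcontr : ∀ h g : H, Hb Sb (T h) (T h) (T g) ≤ α * Sb h h g)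
    (h : ℕ → H) (hmem : ∀ i : ℕ, h (i + 1) ∈ T (h i))
    (hineq : ∀ i : ℕ, Sb (h (i + 1)) (h (i + 1)) (h (i + 2)) ≤
      Hb Sb (T (h i)) (T (h i)) (T (h (i + 1))) + α ^ (i + 1)) :
    ∀ i : ℕ, 1 ≤ i →
      Sb (h i) (h i) (h (i + 1)) ≤ α ^ i * Sb (h 0) (h 0) (h 1) + (i : ℝ) * α ^ i := by
  intro i _
  induction i with
  | zero => simp
  | succ k ih =>
    have ih' : Sb (h k) (h k) (h (k + 1)) ≤ α ^ k * Sb (h 0) (h 0) (h 1) + (k : ℝ) * α ^ k := by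
      rcases Nat.eq_zero_or_pos k with rfl | hk
      · simp
      · exact ih hk
    have h1 := hineq k
    have h2 := hcontr (h k) (h (k + 1))
    have h3 := mul_le_mul_of_nonneg_left ih' hα0
    calc Sb (h (k + 1)) (h (k + 1)) (h (k + 1 + 1))
        ≤ α * (α ^ k * Sb (h 0) (h 0) (h 1) + (k : ℝ) * α ^ k) + α ^ (k + 1) :=
          le_trans h1 (by linarith)
      _ = _ := by push_cast; ring
end

section
/- Let (H, S_b, s) be a symmetric S_b-metric space with coefficient s ≥ 1, let 0 ≤ α < 1/s, let C ≥ 0, and let {h_n} be a sequence in H with S_b(h_n, h_n, h_{n+1}) ≤ α^n C + n α^n for all n ≥ 1. Then {h_n} is a Cauchy sequence, i.e., S_b(h_n, h_n, h_m) → 0 as n, m → ∞. -/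
open Filter Topology

theorem stmt_10 {H : Type*}
    (s : ℝ) (hs : 1 ≤ s) (Sb : H → H → H → ℝ)
    (hnonneg : ∀ u w v, 0 ≤ Sb u w v)
    (hzero : ∀ u w v, Sb u w v = 0 ↔ u = w ∧ w = v)
    (htri : ∀ u w v t, Sb u w v ≤ s * (Sb u u t + Sb w w t + Sb v v t))
    (hsym : ∀ u w, Sb u u w = Sb w w u)
    (α : ℝ) (hα0 : 0 ≤ α) (hα : α < 1 / s)
    (C : ℝ) (hC : 0 ≤ C)
    (h : ℕ → H)
    (hineq : ∀ n : ℕ, 1 ≤ n →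
      Sb (h n) (h n) (h (n + 1)) ≤ α ^ n * C + (n : ℝ) * α ^ n) :
    SbCauchy Sb h := by
  have hs0 : 0 < s := by linarith
  have hβ0 : 0 ≤ s * α := by positivity
  have hβ1 : s * α < 1 := by
    rw [lt_div_iff₀ hs0] at hα
    linarith
  have hn1 : ‖s * α‖ < 1 := by rwa [Real.norm_of_nonneg hβ0]
  obtain ⟨b, hb⟩ : ∃ b : ℕ → ℝ, b = fun n : ℕ => C * (s * α) ^ n + (n : ℝ) * (s * α) ^ n := ⟨_, rfl⟩
  have hb0 : ∀ n, 0 ≤ b n := by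
    intro n
    rw [hb]
    positivity
  have hsum : Summable b := by
    rw [hb]
    refine ((summable_geometric_of_lt_one hβ0 hβ1).mul_left C).add ?_
    simpa using summable_pow_mul_geometric_of_norm_lt_one 1 hn1
  obtain ⟨T, hT⟩ : ∃ T : ℕ → ℝ, T = fun n => ∑' i, b (i + n) := ⟨_, rfl⟩
  have hT0 : ∀ n, 0 ≤ T n := by
    intro n
    rw [hT]
    exact tsum_nonneg fun i => hb0 _
  have hTs : ∀ n, T n = b n + T (n + 1) := by
    intro n
    have h1 := ((summable_nat_add_iff n).2 hsum).tsum_eq_zero_add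
    rw [hT]
    simp only [zero_add] at h1
    simp only [h1]
    congr 1
    apply tsum_congr
    intro i
    congr 1
    ring
  have hTlim : Tendsto T atTop (𝓝 0) := by
    rw [hT]
    exact tendsto_sum_nat_add b
  have key : ∀ k n : ℕ, 1 ≤ n → s ^ n * Sb (h n) (h n) (h (n + k)) ≤ 2 * s * T n := by
    intro k
    induction k with
    | zero =>
      intro n _
      have h0 : Sb (h n) (h n) (h (n + 0)) = 0 := (hzero _ _ _).2 ⟨rfl, rfl⟩
      rw [h0, mul_zero]
      have := hT0 n
      positivity
    | succ k ih =>
      intro n hn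
      have h1 := ih (n + 1) (by omega)
      have e : n + 1 + k = n + (k + 1) := by ring
      rw [e] at h1
      have h2 := htri (h n) (h n) (h (n + (k + 1))) (h (n + 1))
      rw [hsym (h (n + (k + 1))) (h (n + 1))] at h2
      have hp : 0 < s ^ n := by positivity
      have h3 : s ^ n * Sb (h n) (h n) (h (n + 1)) ≤ b n := by
        calc _ ≤ s ^ n * (α ^ n * C + (n : ℝ) * α ^ n) :=
              mul_le_mul_of_nonneg_left (hineq n hn) hp.le
          _ = b n := by rw [hb]; simp only [mul_pow]; ring
      have h4 := mul_le_mul_of_nonneg_left h2 hp.le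
      have h5 := mul_le_mul_of_nonneg_left h3 hs0.le
      rw [pow_succ] at h1
      rw [hTs n]
      linarith
  have key2 : ∀ n m : ℕ, 1 ≤ n → n ≤ m → Sb (h n) (h n) (h m) ≤ 2 * s * T n := by
    intro n m hn hnm
    obtain ⟨k, rfl⟩ := Nat.exists_eq_add_of_le hnm
    have h1 := key k n hn
    have h2 : 1 ≤ s ^ n := one_le_pow₀ hs
    have h3 := le_mul_of_one_le_left (hnonneg (h n) (h n) (h (n + k))) h2
    linarith
  unfold SbCauchy
  have hl : Tendsto (fun p : ℕ × ℕ => 2 * s * T p.1 + 2 * s * T p.2) atTop (𝓝 0) := by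
    rw [← prod_atTop_atTop_eq]
    have t1 : Tendsto (fun p : ℕ × ℕ => T p.1) (atTop ×ˢ atTop) (𝓝 0) := hTlim.comp tendsto_fst
    have t2 : Tendsto (fun p : ℕ × ℕ => T p.2) (atTop ×ˢ atTop) (𝓝 0) := hTlim.comp tendsto_snd
    have := (t1.const_mul (2 * s)).add (t2.const_mul (2 * s))
    simpa using this
  refine squeeze_zero' (Eventually.of_forall fun p => hnonneg _ _ _) ?_ hl
  filter_upwards [eventually_ge_atTop ((1, 1) : ℕ × ℕ)] with p hp
  obtain ⟨hp1, hp2⟩ := hp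
  have a1 : 0 ≤ 2 * s * T p.1 := mul_nonneg (by positivity) (hT0 _)
  have a2 : 0 ≤ 2 * s * T p.2 := mul_nonneg (by positivity) (hT0 _)
  rcases le_total p.1 p.2 with hle | hle
  · have := key2 _ _ hp1 hle
    linarith
  · have := key2 _ _ hp2 hle
    rw [hsym]
    linarith
end

section
/- (Kikkawa–Suzuki type theorem on S_b-metric spaces.) Let (H, S_b, s) be a complete symmetric S_b-metric space with coefficient s ≥ 1, define η(r) = 1/(s(2+r)), and let T : H → CB(H) be a multivalued map. Assume there exists r with 0 ≤ r < 1/s such that for all h, t ∈ H, η(r) D_b(h, T h) ≤ S_b(h,h,t) implies H_b(T h, T h, T t) ≤ r S_b(h,h,t). Then there exists z ∈ H with z ∈ T z. -/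
open Filter Topology

theorem exists_of_Db_lt {H : Type*} (Sb : H → H → H → ℝ) (h : H) (R : Set H)
    (hR : R.Nonempty) (e : ℝ) (he : Db Sb h R < e) : ∃ y ∈ R, Sb h h y < e := by
  obtain ⟨_, ⟨y, hy, rfl⟩, h2⟩ := exists_lt_of_csInf_lt (hR.image _) he
  exact ⟨y, hy, h2⟩

theorem Db_le_of_mem {H : Type*} (Sb : H → H → H → ℝ) (hnonneg : ∀ u w v, 0 ≤ Sb u w v)
    (h : H) (R : Set H) (y : H) (hy : y ∈ R) : Db Sb h R ≤ Sb h h y :=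
  csInf_le ⟨0, by rintro _ ⟨z, _, rfl⟩; exact hnonneg _ _ _⟩ ⟨y, hy, rfl⟩

theorem Db_le_Hb {H : Type*} (s : ℝ) (hs : 1 ≤ s) (Sb : H → H → H → ℝ)
    (hnonneg : ∀ u w v, 0 ≤ Sb u w v)
    (hd : ∀ u v t, Sb u u v ≤ s * (2 * Sb u u t + Sb t t v))
    (P Q : Set H) (hP : SbBounded Sb P) (hQ : Q.Nonempty) (p : H) (hp : p ∈ P) :
    Db Sb p Q ≤ Hb Sb P P Q := by
  have h1 : Db Sb p Q ≤ sSup ((fun p => Db Sb p Q) '' P) := by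
    refine le_csSup ?_ (Set.mem_image_of_mem _ hp)
    obtain ⟨M, hM⟩ := hP
    obtain ⟨q, hq⟩ := hQ
    refine ⟨s * (2 * M + Sb p p q), ?_⟩
    rintro _ ⟨a, ha, rfl⟩
    refine (Db_le_of_mem Sb hnonneg a Q q hq).trans ((hd a q p).trans ?_)
    have := hM a ha a ha p hp
    gcongr
  exact h1.trans ((le_max_right _ _).trans (le_max_left _ _))

theorem stmt_11 {H : Type*} [Nonempty H]
    (s : ℝ) (hs : 1 ≤ s) (Sb : H → H → H → ℝ)
    (hnonneg : ∀ u w v, 0 ≤ Sb u w v)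
    (hzero : ∀ u w v, Sb u w v = 0 ↔ u = w ∧ w = v)
    (htri : ∀ u w v t, Sb u w v ≤ s * (Sb u u t + Sb w w t + Sb v v t))
    (hsym : ∀ u w, Sb u u w = Sb w w u)
    (hcomp : SbComplete Sb)
    (T : H → Set H) (hT : ∀ h, IsCB Sb (T h))
    (r : ℝ) (hr0 : 0 ≤ r) (hr : r < 1 / s)
    (hcond : ∀ h t : H, (1 / (s * (2 + r))) * Db Sb h (T h) ≤ Sb h h t →
      Hb Sb (T h) (T h) (T t) ≤ r * Sb h h t) :
    ∃ z : H, z ∈ T z := by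
  by_contra hno
  push Not at hno
  have hs0 : 0 < s := by linarith
  have hd : ∀ u v t, Sb u u v ≤ s * (2 * Sb u u t + Sb t t v) := by
    intro u v t
    have := htri u u v t
    rw [hsym v t] at this
    linarith
  have hd' : ∀ u v t, Sb u u v ≤ s * (Sb u u t + 2 * Sb t t v) := by
    intro u v t
    have := hd v u t
    rw [hsym v u, hsym v t, hsym t u] at this
    linarith
  have hr1 : r < 1 := hr.trans_le (by rw [div_le_one hs0]; exact hs)
  obtain ⟨k, hrk, hk⟩ := exists_between (lt_min hr (by linarith : r < (1 + r) / 2))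
  have hk1 : k < 1 / s := hk.trans_le (min_le_left _ _)
  have hk2 : k < (1 + r) / 2 := hk.trans_le (min_le_right _ _)
  have hk0 : 0 ≤ k := by linarith
  have hsk : s * k < 1 := by rw [lt_div_iff₀ hs0] at hk1; linarith
  have hη : 0 < 1 / (s * (2 + r)) := by positivity
  have hη1 : 1 / (s * (2 + r)) ≤ 1 := by
    rw [div_le_one (by positivity)]; nlinarith
  have hpos : ∀ x y, y ∈ T x → 0 < Sb x x y := by
    intro x y hy
    refine lt_of_le_of_ne (hnonneg _ _ _) fun h => ?_
    have := ((hzero x x y).1 h.symm).2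
    exact hno x (this ▸ hy)
  have step : ∀ p : {p : H × H // p.2 ∈ T p.1}, ∃ y ∈ T p.1.2,
      Sb p.1.2 p.1.2 y < k * Sb p.1.1 p.1.1 p.1.2 := by
    rintro ⟨⟨x, y⟩, hy⟩
    simp only at hy ⊢
    apply exists_of_Db_lt _ _ _ (hT y).1
    have h1 := Db_le_of_mem Sb hnonneg x (T x) y hy
    have h0 := hpos x y hy
    have h2 := hcond x y (by nlinarith)
    have h3 := Db_le_Hb s hs Sb hnonneg hd (T x) (T y) (hT x).2.2 (hT y).1 y hy
    nlinarith
  choose f hf1 hf2 using step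
  obtain ⟨a0⟩ := ‹Nonempty H›
  obtain ⟨a1, ha1⟩ := (hT a0).1
  let q : ℕ → {p : H × H // p.2 ∈ T p.1} := fun n =>
    Nat.rec ⟨(a0, a1), ha1⟩ (fun _ p => ⟨(p.1.2, f p), hf1 p⟩) n
  obtain ⟨x, hxT, hxd⟩ : ∃ x : ℕ → H, (∀ n, x (n+1) ∈ T (x n)) ∧
      ∀ n, Sb (x (n+1)) (x (n+1)) (x (n+2)) ≤ k * Sb (x n) (x n) (x (n+1)) :=
    ⟨fun n => (q n).1.1, fun n => (q n).2, fun n => (hf2 (q n)).le⟩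
  have hgeo : ∀ n, Sb (x n) (x n) (x (n+1)) ≤ k ^ n * Sb (x 0) (x 0) (x 1) := by
    intro n
    induction n with
    | zero => simp
    | succ n ih =>
      refine (hxd n).trans ?_
      rw [pow_succ']
      nlinarith
  obtain ⟨C, hC0, hC⟩ : ∃ C : ℝ, 0 ≤ C ∧ s * (2 + C * k) = C := by
    have : 0 < 1 - s * k := by linarith
    refine ⟨2 * s / (1 - s * k), by positivity, ?_⟩
    field_simp
    ring
  have hcau : ∀ j n, Sb (x n) (x n) (x (n+j)) ≤ C * Sb (x n) (x n) (x (n+1)) := by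
    intro j
    induction j with
    | zero =>
      intro n
      have h0 : Sb (x n) (x n) (x (n+0)) = 0 := (hzero _ _ _).2 ⟨rfl, rfl⟩
      rw [h0]
      exact mul_nonneg hC0 (hnonneg _ _ _)
    | succ j ih =>
      intro n
      have h1 := ih (n+1)
      rw [show n + 1 + j = n + (j + 1) by ring] at h1
      have h2 := hd (x n) (x (n+(j+1))) (x (n+1))
      have h3 := hxd n
      calc _ ≤ _ := h2
        _ ≤ s * (2 * Sb (x n) (x n) (x (n+1)) + C * (k * Sb (x n) (x n) (x (n+1)))) := by
          have := mul_le_mul_of_nonneg_left h3 hC0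
          gcongr
          exact h1.trans this
        _ = s * (2 + C * k) * Sb (x n) (x n) (x (n+1)) := by ring
        _ = _ := by rw [hC]
  have hk11 : k < 1 := by linarith
  have hlim0 : Tendsto (fun n : ℕ => C * (k ^ n * Sb (x 0) (x 0) (x 1))) atTop (nhds 0) := by
    have := ((tendsto_pow_atTop_nhds_zero_of_lt_one hk0 hk11).mul_const
      (Sb (x 0) (x 0) (x 1))).const_mul C
    simpa using this
  have hC2 : SbCauchy Sb x := by
    unfold SbCauchy
    rw [Metric.tendsto_atTop]
    intro ε hε
    obtain ⟨N, hN⟩ := (Metric.tendsto_atTop.1 hlim0) ε hε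
    have key : ∀ n m, N ≤ n → n ≤ m → Sb (x n) (x n) (x m) < ε := by
      intro n m hn hm
      obtain ⟨j, rfl⟩ := Nat.exists_eq_add_of_le hm
      have h1 := hcau j n
      have h2 := mul_le_mul_of_nonneg_left (hgeo n) hC0
      have h3 := hN n hn
      rw [Real.dist_eq, sub_zero] at h3
      have := le_abs_self (C * (k ^ n * Sb (x 0) (x 0) (x 1)))
      linarith
    refine ⟨(N, N), ?_⟩
    rintro ⟨n, m⟩ ⟨hn, hm⟩
    simp only at hn hm ⊢
    rw [Real.dist_eq, sub_zero, abs_of_nonneg (hnonneg _ _ _)]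
    rcases le_total n m with h | h
    · exact key n m hn h
    · rw [hsym]; exact key m n hm h
  obtain ⟨z, hz⟩ := hcomp x hC2
  unfold SbConvergesTo at hz
  have hfreq : ∀ N, ∃ n ≥ N, Db Sb (x (n+1)) (T z) ≤ r * Sb (x n) (x n) z := by
    intro N
    have hc : ∃ n ≥ N, (1 / (s * (2 + r))) * Db Sb (x n) (T (x n)) ≤ Sb (x n) (x n) z := by
      by_contra hcon
      push Not at hcon
      have h1 := hcon N le_rfl
      have h2 := hcon (N+1) (by omega)
      have e1 := Db_le_of_mem Sb hnonneg (x N) _ _ (hxT N)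
      have e2 := Db_le_of_mem Sb hnonneg (x (N+1)) _ _ (hxT (N+1))
      have h3 := hd' (x N) (x (N+1)) z
      rw [hsym z] at h3
      have hp := hpos _ _ (hxT N)
      have h4 := hxd N
      set d := Sb (x N) (x N) (x (N+1))
      have e1' := mul_le_mul_of_nonneg_left e1 hη.le
      have e2' := mul_le_mul_of_nonneg_left (e2.trans h4) hη.le
      have h5 : d < s * (1 / (s * (2 + r)) * d + 2 * (1 / (s * (2 + r)) * (k * d))) := by
        refine h3.trans_lt ?_
        apply mul_lt_mul_of_pos_left _ hs0
        linarith
      have h6 : s * (1 / (s * (2 + r)) * d + 2 * (1 / (s * (2 + r)) * (k * d)))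
          = (1 + 2 * k) * d / (2 + r) := by
        field_simp
      rw [h6, lt_div_iff₀ (by linarith)] at h5
      nlinarith
    obtain ⟨n, hn, h⟩ := hc
    refine ⟨n, hn, (Db_le_Hb s hs Sb hnonneg hd _ _ (hT (x n)).2.2 (hT z).1 _ (hxT n)).trans
      (hcond _ _ h)⟩
  have happ : ∀ ε > 0, ∃ y ∈ T z, Sb y y z < ε := by
    intro ε hε
    obtain ⟨δ, hδ, hδε⟩ : ∃ δ > 0, s * (5 * δ) = ε := ⟨ε / (5 * s), by positivity, by field_simp⟩
    obtain ⟨N, hN⟩ := (Metric.tendsto_atTop.1 hz) δ hδ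
    obtain ⟨n, hn, h⟩ := hfreq N
    have h1 := hN n hn
    have h2 := hN (n+1) (by omega)
    rw [Real.dist_eq, sub_zero, abs_of_nonneg (hnonneg _ _ _)] at h1 h2
    obtain ⟨y, hy, h3⟩ := exists_of_Db_lt Sb (x (n+1)) (T z) (hT z).1 (2 * δ)
      (by nlinarith [hnonneg (x n) (x n) z])
    refine ⟨y, hy, ?_⟩
    rw [← hδε]
    refine (hd y z (x (n+1))).trans_lt ?_
    apply mul_lt_mul_of_pos_left _ hs0
    rw [hsym y]
    linarith
  choose y hy1 hy2 using fun n : ℕ => happ (1 / ((n : ℝ) + 1)) (by positivity)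
  refine hno z ((hT z).2.1 y z hy1 ?_)
  exact squeeze_zero (fun n => hnonneg _ _ _) (fun n => (hy2 n).le)
    tendsto_one_div_add_atTop_nhds_zero_nat
end

section
/- Let (H, S_b, s) be a symmetric S_b-metric space with coefficient s ≥ 1, let 0 ≤ r₁ < 1/s, and let {u_n} be a sequence in H with S_b(u_n, u_n, u_{n+1}) ≤ r₁ S_b(u_{n-1}, u_{n-1}, u_n) for all n ≥ 1. Then for all m ≥ n one has S_b(u_n, u_n, u_m) ≤ (2 s r₁^n (1 − (s r₁)^{m−n}) / (1 − s r₁)) S_b(u_0, u_0, u_1); in particular {u_n} is a Cauchy sequence. -/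
open Filter Topology

theorem stmt_12 {H : Type*}
    (s : ℝ) (hs : 1 ≤ s) (Sb : H → H → H → ℝ)
    (hnonneg : ∀ u w v, 0 ≤ Sb u w v)
    (hzero : ∀ u w v, Sb u w v = 0 ↔ u = w ∧ w = v)
    (htri : ∀ u w v t, Sb u w v ≤ s * (Sb u u t + Sb w w t + Sb v v t))
    (hsym : ∀ u w, Sb u u w = Sb w w u)
    (r₁ : ℝ) (hr0 : 0 ≤ r₁) (hr : r₁ < 1 / s)
    (u : ℕ → H)
    (hineq : ∀ n : ℕ,
      Sb (u (n + 1)) (u (n + 1)) (u (n + 2)) ≤ r₁ * Sb (u n) (u n) (u (n + 1))) :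
    (∀ n m : ℕ, n ≤ m →
      Sb (u n) (u n) (u m) ≤
        2 * s * r₁ ^ n * (1 - (s * r₁) ^ (m - n)) / (1 - s * r₁) *
          Sb (u 0) (u 0) (u 1)) ∧
    SbCauchy Sb u := by
  have hs0 : 0 < s := by linarith
  have hsr : s * r₁ < 1 := by
    rw [lt_div_iff₀ hs0] at hr
    linarith
  have hsr0 : 0 ≤ s * r₁ := by positivity
  have hr1 : r₁ < 1 := by nlinarith
  have hden : 0 < 1 - s * r₁ := by linarith
  have hd0 := hnonneg (u 0) (u 0) (u 1)
  have hd : ∀ n : ℕ, Sb (u n) (u n) (u (n + 1)) ≤ r₁ ^ n * Sb (u 0) (u 0) (u 1) := by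
    intro n
    induction n with
    | zero => simp
    | succ k ih =>
      calc _ ≤ _ := hineq k
        _ ≤ r₁ * (r₁ ^ k * Sb (u 0) (u 0) (u 1)) := mul_le_mul_of_nonneg_left ih hr0
        _ = _ := by ring
  have key : ∀ k n : ℕ, Sb (u n) (u n) (u (n + k)) ≤
      2 * s * r₁ ^ n * (1 - (s * r₁) ^ k) / (1 - s * r₁) * Sb (u 0) (u 0) (u 1) := by
    intro k
    induction k with
    | zero =>
      intro n
      simp [(hzero (u n) (u n) (u n)).2 ⟨rfl, rfl⟩]
    | succ k ih =>
      intro n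
      have h1 := htri (u n) (u n) (u (n + (k + 1))) (u (n + 1))
      have h2 := ih (n + 1)
      rw [hsym (u (n + (k + 1)))] at h1
      rw [show n + 1 + k = n + (k + 1) by ring] at h2
      calc _ ≤ _ := h1
        _ ≤ s * (r₁ ^ n * Sb (u 0) (u 0) (u 1) + r₁ ^ n * Sb (u 0) (u 0) (u 1) + _) :=
          mul_le_mul_of_nonneg_left (add_le_add (add_le_add (hd n) (hd n)) h2) hs0.le
        _ = _ := by
          have := hden.ne'
          field_simp
          ring
  have main : ∀ n m : ℕ, n ≤ m →
      Sb (u n) (u n) (u m) ≤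
        2 * s * r₁ ^ n * (1 - (s * r₁) ^ (m - n)) / (1 - s * r₁) *
          Sb (u 0) (u 0) (u 1) := by
    intro n m h
    have := key (m - n) n
    rwa [Nat.add_sub_cancel' h] at this
  refine ⟨main, ?_⟩
  have hC : 0 ≤ 2 * s / (1 - s * r₁) * Sb (u 0) (u 0) (u 1) := by positivity
  have main2 : ∀ n m : ℕ, n ≤ m → Sb (u n) (u n) (u m) ≤
      2 * s / (1 - s * r₁) * Sb (u 0) (u 0) (u 1) * r₁ ^ n := by
    intro n m h
    have h0 : 0 ≤ (s * r₁) ^ (m - n) := by positivity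
    have h1 : 0 ≤ 2 * s / (1 - s * r₁) * Sb (u 0) (u 0) (u 1) * r₁ ^ n := by positivity
    calc _ ≤ _ := main n m h
      _ = 2 * s / (1 - s * r₁) * Sb (u 0) (u 0) (u 1) * r₁ ^ n * (1 - (s * r₁) ^ (m - n)) := by
        ring
      _ ≤ _ := mul_le_of_le_one_right h1 (by linarith)
  have hlim := tendsto_pow_atTop_nhds_zero_of_lt_one hr0 hr1
  unfold SbCauchy
  rw [← Filter.prod_atTop_atTop_eq]
  have hl : Filter.Tendsto (fun p : ℕ × ℕ => 2 * s / (1 - s * r₁) * Sb (u 0) (u 0) (u 1) *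
      (r₁ ^ p.1 + r₁ ^ p.2)) (Filter.atTop ×ˢ Filter.atTop) (nhds 0) := by
    have := ((hlim.comp (Filter.tendsto_fst (f := Filter.atTop) (g := Filter.atTop (α := ℕ)))).add
      (hlim.comp (Filter.tendsto_snd (f := Filter.atTop (α := ℕ)) (g := Filter.atTop)))).const_mul
      (2 * s / (1 - s * r₁) * Sb (u 0) (u 0) (u 1))
    simpa using this
  refine squeeze_zero (fun p => hnonneg _ _ _) (fun p => ?_) hl
  have ha : 0 ≤ 2 * s / (1 - s * r₁) * Sb (u 0) (u 0) (u 1) * r₁ ^ p.1 := by positivity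
  have hb : 0 ≤ 2 * s / (1 - s * r₁) * Sb (u 0) (u 0) (u 1) * r₁ ^ p.2 := by positivity
  rw [mul_add]
  rcases le_total p.1 p.2 with h | h
  · linarith [main2 _ _ h]
  · rw [hsym]
    linarith [main2 _ _ h]
end

section
/- Let (H, S_b, s) be a complete symmetric S_b-metric space with coefficient s ≥ 1, let η(r) = 1/(s(2+r)), and let T : H → CB(H) satisfy, for some 0 ≤ r < 1/s: for all h, t ∈ H, η(r) D_b(h, T h) ≤ S_b(h,h,t) implies H_b(T h, T h, T t) ≤ r S_b(h,h,t). Suppose {u_n} is a sequence in H with u_{n+1} ∈ T u_n for all n, converging to a point z ∈ H. Then for every h ∈ H with h ≠ z, D_b(z, T h) ≤ r S_b(z,z,h). -/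
open Filter Topology

theorem Db_le_aux {H : Type*} (Sb : H → H → H → ℝ) (hnonneg : ∀ u w v, 0 ≤ Sb u w v)
    (h q : H) (Q : Set H) (hq : q ∈ Q) : Db Sb h Q ≤ Sb h h q :=
  csInf_le ⟨0, by rintro _ ⟨x, _, rfl⟩; exact hnonneg _ _ _⟩ ⟨q, hq, rfl⟩

theorem Db_le_Hb_aux {H : Type*} (s : ℝ) (hs : 1 ≤ s) (Sb : H → H → H → ℝ)
    (hnonneg : ∀ u w v, 0 ≤ Sb u w v)
    (htri : ∀ u w v t, Sb u w v ≤ s * (Sb u u t + Sb w w t + Sb v v t))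
    (P Q : Set H) (hP : IsCB Sb P) (hQ : IsCB Sb Q) (p : H) (hp : p ∈ P) :
    Db Sb p Q ≤ Hb Sb P P Q := by
  obtain ⟨q, hq⟩ := hQ.1
  obtain ⟨M, hM⟩ := hP.2.2
  have h1 : Db Sb p Q ≤ sSup ((fun p => Db Sb p Q) '' P) := by
    refine le_csSup ⟨s * (M + M + Sb q q p), ?_⟩ ⟨p, hp, rfl⟩
    rintro _ ⟨x, hx, rfl⟩
    have h2 := Db_le_aux Sb hnonneg x q Q hq
    have h3 := htri x x q p
    have h4 := hM x hx x hx p hp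
    refine h2.trans (h3.trans ?_)
    gcongr
  exact h1.trans ((le_max_right _ _).trans (le_max_left _ _))

theorem stmt_13 {H : Type*}
    (s : ℝ) (hs : 1 ≤ s) (Sb : H → H → H → ℝ)
    (hnonneg : ∀ u w v, 0 ≤ Sb u w v)
    (hzero : ∀ u w v, Sb u w v = 0 ↔ u = w ∧ w = v)
    (htri : ∀ u w v t, Sb u w v ≤ s * (Sb u u t + Sb w w t + Sb v v t))
    (hsym : ∀ u w, Sb u u w = Sb w w u)
    (hcomp : SbComplete Sb)
    (T : H → Set H) (hT : ∀ h, IsCB Sb (T h))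
    (r : ℝ) (hr0 : 0 ≤ r) (hr : r < 1 / s)
    (hcond : ∀ h t : H, (1 / (s * (2 + r))) * Db Sb h (T h) ≤ Sb h h t →
      Hb Sb (T h) (T h) (T t) ≤ r * Sb h h t)
    (u : ℕ → H) (hmem : ∀ n : ℕ, u (n + 1) ∈ T (u n))
    (z : H) (hconv : SbConvergesTo Sb u z) :
    ∀ h : H, h ≠ z → Db Sb z (T h) ≤ r * Sb z z h := by
  intro h _
  have hs0 : 0 < s := by linarith
  have hr1 : r ≤ 1 := by
    have : 1 / s ≤ 1 := by rw [div_le_one hs0]; exact hs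
    linarith
  have hk : 0 < s * (2 + r) := by positivity
  have hDH := fun a b p hp => Db_le_Hb_aux s hs Sb hnonneg htri (T a) (T b) (hT a) (hT b) p hp
  have hDnn : ∀ a b, 0 ≤ Db Sb a (T b) := fun a b =>
    Real.sInf_nonneg (by rintro _ ⟨x, _, rfl⟩; exact hnonneg _ _ _)
  have hfreq : ∀ N, ∃ n, N ≤ n ∧ (1 / (s * (2 + r))) * Db Sb (u n) (T (u n)) ≤ Sb (u n) (u n) z := by
    intro N
    by_contra! hcon
    have e1 := hcon N le_rfl
    have e2 := hcon (N + 1) (Nat.le_succ N)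
    rw [one_div, inv_mul_eq_div, lt_div_iff₀ hk] at e1 e2
    have e3 := Db_le_aux Sb hnonneg (u N) (u (N + 1)) _ (hmem N)
    have e4 := htri (u N) (u N) (u (N + 1)) z
    have e5 : (1 / (s * (2 + r))) * Db Sb (u N) (T (u N)) ≤ Sb (u N) (u N) (u (N + 1)) := by
      refine le_trans ?_ e3
      refine mul_le_of_le_one_left (hDnn _ _) ?_
      rw [div_le_one hk]
      nlinarith
    have e6 := (hDH (u N) (u (N + 1)) _ (hmem N)).trans (hcond _ _ e5)
    generalize Sb (u N) (u N) z = a at *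
    generalize Sb (u (N + 1)) (u (N + 1)) z = b at *
    have f1 : s * (a * (2 + r)) < s * (a + a + b) := by nlinarith
    have f2 : s * (b * (2 + r)) < s * (r * (a + a + b)) := by
      have := mul_le_mul_of_nonneg_left e4 hr0
      nlinarith
    have g1 := lt_of_mul_lt_mul_left f1 hs0.le
    have g2 := lt_of_mul_lt_mul_left f2 hs0.le
    nlinarith
  have hz : z ∈ T z := by
    have key : ∀ k : ℕ, ∃ x ∈ T z, Sb x x z ≤ 3 * s * (1 / ((k : ℝ) + 1)) := by
      intro k
      have hd : (0 : ℝ) < 1 / ((k : ℝ) + 1) := by positivity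
      generalize 1 / ((k : ℝ) + 1) = δ at *
      obtain ⟨N, hN⟩ := eventually_atTop.1 (hconv.eventually (gt_mem_nhds hd))
      obtain ⟨n, hn, hη⟩ := hfreq N
      have a1 := hN n hn
      have a2 := hN (n + 1) (by omega)
      have a3 := (hDH (u n) z _ (hmem n)).trans (hcond _ _ hη)
      have a4 : Db Sb (u (n + 1)) (T z) < δ := by
        have := mul_le_of_le_one_left (hnonneg (u n) (u n) z) hr1
        linarith
      obtain ⟨_, ⟨x, hx, rfl⟩, hlt⟩ := exists_lt_of_csInf_lt ((hT z).1.image _) a4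
      refine ⟨x, hx, ?_⟩
      have b1 := htri z z x (u (n + 1))
      rw [hsym x z]
      rw [hsym z (u (n + 1)), hsym x (u (n + 1))] at b1
      have hlt' : Sb (u (n + 1)) (u (n + 1)) x < δ := hlt
      nlinarith
    choose x hx hxle using key
    refine (hT z).2.1 x z hx ?_
    have hl := (tendsto_one_div_add_atTop_nhds_zero_nat (𝕜 := ℝ)).const_mul (3 * s)
    rw [mul_zero] at hl
    exact squeeze_zero (fun n => hnonneg _ _ _) hxle hl
  refine (hDH z h z hz).trans (hcond z h ?_)
  have hzz : Db Sb z (T z) ≤ 0 := by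
    have := Db_le_aux Sb hnonneg z z _ hz
    rwa [(hzero z z z).2 ⟨rfl, rfl⟩] at this
  have hzz' : Db Sb z (T z) = 0 := le_antisymm hzz (hDnn _ _)
  rw [hzz', mul_zero]
  exact hnonneg _ _ _
end
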